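/- Let a < b and let h : [a,b] → [0,∞) be lower semicontinuous with finite pointwise variation. Define Ω_h := {(x,y) ∈ ℝ² : a < x < b, y < h(x)} and h⁺(x) := limsup_{z → x} h(z). Then the topological boundary of Ω_h intersected with the open strip (a,b) × ℝ equals {(x,y) ∈ ℝ² : a < x < b, h(x) ≤ y ≤ h⁺(x)}. -/

import Mathlib

open MeasureTheory Filter Set

/-- For a lower semicontinuous `h : [a,b] → [0,∞)` of finite pointwise variation, the part
of the topological boundary of the subgraph `Ω_h` lying in the open strip `(a,b) × ℝ` is
`{(x,y) : a < x < b, h(x) ≤ y ≤ h⁺(x)}`, where `h⁺(x) := limsup_{z→x} h(z)`. -/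
theorem stmt_10 (a b : ℝ) (hab : a < b)
    (h : ℝ → ℝ) (hnonneg : ∀ x ∈ Icc a b, 0 ≤ h x)
    (hlsc : LowerSemicontinuousOn h (Icc a b))
    (hbv : BoundedVariationOn h (Icc a b))
    (Ω : Set (ℝ × ℝ)) (hΩ : Ω = {p : ℝ × ℝ | a < p.1 ∧ p.1 < b ∧ p.2 < h p.1})
    (hp : ℝ → ℝ)
    (hhp : ∀ x, hp x = Filter.limsup h (nhdsWithin x (Icc a b \ {x}))) :
    frontier Ω ∩ (Ioo a b ×ˢ (univ : Set ℝ))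
      = {p : ℝ × ℝ | a < p.1 ∧ p.1 < b ∧ h p.1 ≤ p.2 ∧ p.2 ≤ hp p.1} := by
  have hmem : ∀ x, a < x → x < b → Icc a b ∈ nhds x := fun x h1 h2 => Icc_mem_nhds h1 h2
  have hF : ∀ x, a < x → x < b →
      nhdsWithin x (Icc a b \ {x}) = nhdsWithin x ({x}ᶜ : Set ℝ) := by
    intro x h1 h2
    rw [sdiff_eq]
    exact nhdsWithin_inter_of_mem (mem_nhdsWithin_of_mem_nhds (hmem x h1 h2))
  have hIoo : ∀ x, a < x → x < b → ∀ᶠ z in nhds x, z ∈ Ioo a b := fun x h1 h2 => Ioo_mem_nhds h1 h2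
  have hlsc' : ∀ x, a < x → x < b → ∀ c, c < h x → ∀ᶠ z in nhds x, c < h z := by
    intro x h1 h2 c hc
    have := hlsc x ⟨h1.le, h2.le⟩ c hc
    rwa [nhdsWithin_eq_nhds.2 (hmem x h1 h2)] at this
  have hbd : ∃ M, ∀ z ∈ Icc a b, h z ≤ M := by
    refine ⟨h a + (eVariationOn h (Icc a b)).toReal, fun z hz => ?_⟩
    have h1 := hbv.dist_le hz (left_mem_Icc.2 hab.le)
    rw [Real.dist_eq] at h1
    linarith [le_abs_self (h z - h a)]
  obtain ⟨M, hM⟩ := hbd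
  have hev : ∀ x, a < x → x < b → ∀ᶠ z in nhdsWithin x ({x}ᶜ : Set ℝ), z ∈ Icc a b :=
    fun x h1 h2 => mem_nhdsWithin_of_mem_nhds (hmem x h1 h2)
  have hB : ∀ x, a < x → x < b →
      (nhdsWithin x ({x}ᶜ : Set ℝ)).IsBoundedUnder (· ≤ ·) h := fun x h1 h2 =>
    ⟨M, eventually_map.2 ((hev x h1 h2).mono fun z hz => hM z hz)⟩
  have hB' : ∀ x, a < x → x < b →
      (nhdsWithin x ({x}ᶜ : Set ℝ)).IsBoundedUnder (· ≥ ·) h := fun x h1 h2 =>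
    ⟨0, eventually_map.2 ((hev x h1 h2).mono fun z hz => hnonneg z hz)⟩
  have hle : ∀ x, a < x → x < b → h x ≤ hp x := by
    intro x h1 h2
    rw [hhp, hF x h1 h2]
    refine le_of_forall_lt fun c hc => ?_
    obtain ⟨d, hd, hd'⟩ := exists_between hc
    refine lt_of_lt_of_le hd (le_limsup_of_frequently_le ?_ (hB x h1 h2))
    exact Eventually.frequently
      (((hlsc' x h1 h2 d hd').filter_mono nhdsWithin_le_nhds).mono fun z hz => le_of_lt hz)
  have hopen : IsOpen Ω := by
    rw [isOpen_iff_mem_nhds]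
    rintro ⟨x, y⟩ hxy
    rw [hΩ] at hxy ⊢
    obtain ⟨h1, h2, h3⟩ := hxy
    dsimp only at h1 h2 h3
    obtain ⟨c, hc, hc'⟩ := exists_between h3
    rw [nhds_prod_eq]
    filter_upwards [((hIoo x h1 h2).and (hlsc' x h1 h2 c hc')).prod_mk
      (Iio_mem_nhds hc : ∀ᶠ t in nhds y, t ∈ Iio c)]
    rintro ⟨z, t⟩ ⟨⟨hz, hz'⟩, ht⟩
    exact ⟨hz.1, hz.2, lt_trans ht hz'⟩
  rw [hopen.frontier_eq]
  ext ⟨x, y⟩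
  simp only [mem_inter_iff, Set.mem_sdiff, mem_prod, mem_univ, and_true, mem_ofPred_eq, mem_Ioo]
  constructor
  · rintro ⟨⟨hcl, hn⟩, h1, h2⟩
    have hy : h x ≤ y := by
      by_contra hc
      exact hn (by rw [hΩ]; exact ⟨h1, h2, not_le.1 hc⟩)
    refine ⟨h1, h2, hy, ?_⟩
    by_contra hlt
    obtain ⟨c, hc, hc'⟩ := exists_between (not_le.1 hlt)
    have e1 : ∀ᶠ z in nhdsWithin x ({x}ᶜ : Set ℝ), h z < c := by
      refine eventually_lt_of_limsup_lt ?_ (hB x h1 h2)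
      rw [← hF x h1 h2, ← hhp]; exact hc
    rw [eventually_nhdsWithin_iff] at e1
    have e2 : ∀ᶠ z in nhds x, h z < c := by
      filter_upwards [e1] with z hz
      by_cases hzx : z = x
      · rw [hzx]; exact (hle x h1 h2).trans_lt hc
      · exact hz hzx
    have e3 : ∀ᶠ p : ℝ × ℝ in nhds (x, y), h p.1 < c ∧ c < p.2 := by
      rw [nhds_prod_eq]
      exact e2.prod_mk (Ioi_mem_nhds hc' : ∀ᶠ t in nhds y, t ∈ Ioi c)
    obtain ⟨p, hpΩ, hp1, hp2⟩ := ((mem_closure_iff_frequently.1 hcl).and_eventually e3).exists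
    rw [hΩ] at hpΩ
    linarith [hpΩ.2.2]
  · rintro ⟨h1, h2, h3, h4⟩
    refine ⟨⟨?_, ?_⟩, h1, h2⟩
    · rw [Metric.mem_closure_iff]
      intro ε hε
      have f1 : ∃ᶠ z in nhdsWithin x ({x}ᶜ : Set ℝ), y - ε / 2 < h z := by
        refine frequently_lt_of_lt_limsup (hB' x h1 h2).isCoboundedUnder_le ?_
        rw [← hF x h1 h2, ← hhp]; linarith
      have f2 := f1.filter_mono nhdsWithin_le_nhds
      obtain ⟨z, hz, hz1, hz2⟩ := (f2.and_eventually
        ((hIoo x h1 h2).and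
          (Metric.ball_mem_nhds x hε : ∀ᶠ z in nhds x, z ∈ Metric.ball x ε))).exists
      refine ⟨(z, y - ε / 2), by rw [hΩ]; exact ⟨hz1.1, hz1.2, hz⟩, ?_⟩
      rw [Prod.dist_eq, max_lt_iff]
      refine ⟨by rw [dist_comm]; exact hz2, ?_⟩
      simp only [Real.dist_eq]
      rw [abs_lt]; constructor <;> linarith
    · rw [hΩ]
      rintro ⟨-, -, h5⟩
      exact absurd h5 (not_lt.2 h3)
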